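/- Let A be a Poisson algebra, P an n×n matrix and Q an n'×n' matrix over A, and suppose there exist (n·n')×(n·n') matrices D₁₂ and D₂₁ over A such that {P ⊗, Q} = [D₁₂, P⊗I] + [D₂₁, I⊗Q]. Fix k ≥ 1 and define the n'×n' matrix M (a partial trace over the first tensor factor) by M_{ab} = k·Σ_{i,i'} (P^{k−1})_{i i'}·(D₂₁)_{(i',a),(i,b)}, i.e. M = k·tr₁((P^{k−1}⊗I)·D₂₁). Then the Hamiltonian flow of the spectral invariant tr(P^k) on Q has Lax form: for all indices a,b, {tr(P^k), Q_{ab}} = (M·Q − Q·M)_{ab}. -/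

import Mathlib

open Matrix Kronecker

/-- A Poisson algebra: a commutative ring with an additive, antisymmetric bracket
satisfying the Jacobi identity and the Leibniz rule. -/
structure PoissonR (A : Type*) [CommRing A] where
  br : A → A → A
  add_left : ∀ x y z : A, br (x + y) z = br x z + br y z
  add_right : ∀ x y z : A, br x (y + z) = br x y + br x z
  antisymm : ∀ x y : A, br x y = - br y x
  jacobi : ∀ x y z : A, br x (br y z) + br y (br z x) + br z (br x y) = 0
  leibniz : ∀ x y z : A, br x (y * z) = br x y * z + y * br x z

/-- Matrix commutator. -/
def mcomm {A ι : Type*} [CommRing A] [Fintype ι] [DecidableEq ι]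
    (X Y : Matrix ι ι A) : Matrix ι ι A :=
  X * Y - Y * X

/-- Partial trace over the first tensor factor. -/
def partialTrace {A ι κ : Type*} [CommRing A] [Fintype ι]
    (X : Matrix (ι × κ) (ι × κ) A) : Matrix κ κ A :=
  Matrix.of fun a b => ∑ i, X (i, a) (i, b)

section PartialTrace

variable {A ι κ : Type*} [CommRing A] [Fintype ι]

lemma partialTrace_add (X Y : Matrix (ι × κ) (ι × κ) A) :
    partialTrace (X + Y) = partialTrace X + partialTrace Y := by
  ext a b
  simp [partialTrace, Finset.sum_add_distrib]

lemma partialTrace_sub (X Y : Matrix (ι × κ) (ι × κ) A) :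
    partialTrace (X - Y) = partialTrace X - partialTrace Y := by
  ext a b
  simp [partialTrace, Finset.sum_sub_distrib]

variable [Fintype κ]

lemma kronecker_one_mul_apply [DecidableEq κ] (N : Matrix ι ι A)
    (X : Matrix (ι × κ) (ι × κ) A) (p q : ι × κ) :
    ((N ⊗ₖ (1 : Matrix κ κ A)) * X) p q = ∑ j, N p.1 j * X (j, p.2) q := by
  simp [Matrix.mul_apply, Fintype.sum_prod_type, Matrix.one_apply]

lemma mul_kronecker_one_apply [DecidableEq κ] (N : Matrix ι ι A)
    (X : Matrix (ι × κ) (ι × κ) A) (p q : ι × κ) :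
    (X * (N ⊗ₖ (1 : Matrix κ κ A))) p q = ∑ j, X p (j, q.2) * N j q.1 := by
  simp [Matrix.mul_apply, Fintype.sum_prod_type, Matrix.one_apply]

lemma partialTrace_kronecker_one_mul [DecidableEq κ] (N : Matrix ι ι A)
    (X : Matrix (ι × κ) (ι × κ) A) :
    partialTrace ((N ⊗ₖ (1 : Matrix κ κ A)) * X)
      = partialTrace (X * (N ⊗ₖ (1 : Matrix κ κ A))) := by
  ext a b
  simp only [partialTrace, Matrix.of_apply, kronecker_one_mul_apply, mul_kronecker_one_apply]
  rw [Finset.sum_comm]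
  simp only [mul_comm]

lemma partialTrace_one_kronecker_mul [DecidableEq ι] (Q : Matrix κ κ A)
    (X : Matrix (ι × κ) (ι × κ) A) :
    partialTrace (((1 : Matrix ι ι A) ⊗ₖ Q) * X) = Q * partialTrace X := by
  ext a b
  simp only [partialTrace, Matrix.of_apply, Matrix.mul_apply, Fintype.sum_prod_type,
    Matrix.kroneckerMap_apply, Matrix.one_apply, ite_mul, one_mul, zero_mul, Finset.mul_sum]
  rw [Finset.sum_comm (s := (Finset.univ : Finset κ))]
  simp

lemma partialTrace_mul_one_kronecker [DecidableEq ι] (Q : Matrix κ κ A)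
    (X : Matrix (ι × κ) (ι × κ) A) :
    partialTrace (X * ((1 : Matrix ι ι A) ⊗ₖ Q)) = partialTrace X * Q := by
  ext a b
  simp only [partialTrace, Matrix.of_apply, Matrix.mul_apply, Fintype.sum_prod_type,
    Matrix.kroneckerMap_apply, Matrix.one_apply, ite_mul, mul_ite, one_mul, zero_mul, mul_zero,
    Finset.sum_mul]
  rw [Finset.sum_comm (s := (Finset.univ : Finset κ))]
  simp

variable [DecidableEq ι] [DecidableEq κ]

/-- The partial trace of `(N ⊗ 1) [D, P ⊗ 1]` vanishes when `N` commutes with `P`. -/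
lemma partialTrace_kronecker_one_mul_mcomm {N P : Matrix ι ι A} (hNP : Commute N P)
    (D : Matrix (ι × κ) (ι × κ) A) :
    partialTrace ((N ⊗ₖ (1 : Matrix κ κ A)) * mcomm D (P ⊗ₖ (1 : Matrix κ κ A))) = 0 := by
  rw [mcomm, mul_sub, partialTrace_sub, ← mul_assoc, ← mul_assoc,
    ← partialTrace_kronecker_one_mul, ← mul_assoc, ← Matrix.mul_kronecker_mul,
    ← Matrix.mul_kronecker_mul, hNP.eq, sub_self]

lemma partialTrace_kronecker_one_mul_mcomm_one_kronecker (N : Matrix ι ι A) (Q : Matrix κ κ A)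
    (D : Matrix (ι × κ) (ι × κ) A) :
    partialTrace ((N ⊗ₖ (1 : Matrix κ κ A)) * mcomm D ((1 : Matrix ι ι A) ⊗ₖ Q))
      = mcomm (partialTrace ((N ⊗ₖ (1 : Matrix κ κ A)) * D)) Q := by
  have hcomm : (N ⊗ₖ (1 : Matrix κ κ A)) * ((1 : Matrix ι ι A) ⊗ₖ Q)
      = ((1 : Matrix ι ι A) ⊗ₖ Q) * (N ⊗ₖ (1 : Matrix κ κ A)) := by
    simp [← Matrix.mul_kronecker_mul]
  rw [mcomm, mcomm, mul_sub, partialTrace_sub, ← mul_assoc, ← mul_assoc, hcomm, mul_assoc _ _ D,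
    partialTrace_mul_one_kronecker, partialTrace_one_kronecker_mul]

end PartialTrace

/-- For a derivation `d` and `X` commuting with `P`,
`tr (X d(P^(m+1))) = (m+1) tr (X P^m d(P))`. -/
lemma trace_mul_derivation_pow {A ι : Type*} [CommRing A] [Fintype ι] [DecidableEq ι]
    (d : Derivation ℤ A A) (P : Matrix ι ι A) (m : ℕ) :
    ∀ X : Matrix ι ι A, Commute X P →
      (X * (P ^ (m + 1)).map d).trace = (m + 1) • (X * P ^ m * P.map d).trace := by
  have hmul (Y Z : Matrix ι ι A) : (Y * Z).map d = Y.map d * Z + Y * Z.map d := by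
    ext i j
    simp [Matrix.mul_apply, ← Finset.sum_add_distrib, mul_comm, add_comm]
  induction m with
  | zero => simp
  | succ m ih =>
    intro X hX
    rw [pow_succ P (m + 1), hmul, mul_add, Matrix.trace_add, ← mul_assoc, Matrix.trace_mul_comm,
      ← mul_assoc, ih (P * X) ((Commute.refl P).mul_left hX), ← hX.eq, mul_assoc X P,
      ← pow_succ', ← mul_assoc, succ_nsmul _ (m + 1)]

/-- The Hamiltonian derivation `x ↦ {x, y}`. -/
def PoissonR.hamiltonian {A : Type*} [CommRing A] (P : PoissonR A) (y : A) :
    Derivation ℤ A A :=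
  Derivation.mk' (AddMonoidHom.mk' (fun x => P.br x y) fun x z => P.add_left x z y).toIntLinearMap
    fun x z => by
      change P.br (x * z) y = x • P.br z y + z • P.br x y
      rw [P.antisymm, P.leibniz, P.antisymm y x, P.antisymm y z, smul_eq_mul, smul_eq_mul]
      ring

lemma PoissonR.hamiltonian_apply {A : Type*} [CommRing A] (P : PoissonR A) (x y : A) :
    P.hamiltonian y x = P.br x y := rfl

/-- Lax form of the Hamiltonian flow of a spectral invariant:
`{tr(P^k), Q} = [M, Q]` with `M = k·tr₁((P^{k−1}⊗I)·D₂₁)`. -/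
theorem statement6 {A : Type*} [CommRing A] (P : PoissonR A) {n n' : ℕ}
    (Pm : Matrix (Fin n) (Fin n) A) (Qm : Matrix (Fin n') (Fin n') A)
    (D12 D21 : Matrix (Fin n × Fin n') (Fin n × Fin n') A)
    (h : (Matrix.of fun p q => P.br (Pm p.1 q.1) (Qm p.2 q.2))
      = mcomm D12 (Pm ⊗ₖ (1 : Matrix (Fin n') (Fin n') A))
        + mcomm D21 ((1 : Matrix (Fin n) (Fin n) A) ⊗ₖ Qm))
    (k : ℕ) (hk : 1 ≤ k)
    (M : Matrix (Fin n') (Fin n') A)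
    (hM : M = Matrix.of fun a b =>
      k • ∑ i : Fin n, ∑ i' : Fin n, (Pm ^ (k - 1)) i i' * D21 (i', a) (i, b)) :
    ∀ a b : Fin n', P.br (Pm ^ k).trace (Qm a b) = (M * Qm - Qm * M) a b := by
  obtain ⟨m, rfl⟩ : ∃ m, k = m + 1 := ⟨k - 1, by omega⟩
  rw [Nat.add_sub_cancel] at hM
  have hM' : M = (m + 1) • partialTrace (((Pm ^ m) ⊗ₖ (1 : Matrix (Fin n') (Fin n') A)) * D21) := by
    ext a b
    simp [hM, partialTrace, kronecker_one_mul_apply]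
  intro a b
  have htr : P.br (Pm ^ (m + 1)).trace (Qm a b)
      = ((Pm ^ (m + 1)).map (P.hamiltonian (Qm a b))).trace := by
    simp [← P.hamiltonian_apply, Matrix.trace]
  have hflow : (Pm ^ m * Pm.map (P.hamiltonian (Qm a b))).trace
      = partialTrace (((Pm ^ m) ⊗ₖ (1 : Matrix (Fin n') (Fin n') A)) *
        Matrix.of fun p q => P.br (Pm p.1 q.1) (Qm p.2 q.2)) a b := by
    simp only [partialTrace, kronecker_one_mul_apply, Matrix.of_apply]
    simp only [Matrix.trace, Matrix.diag_apply, Matrix.mul_apply, Matrix.map_apply,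
      P.hamiltonian_apply]
  have hpow := trace_mul_derivation_pow (P.hamiltonian (Qm a b)) Pm m 1 (Commute.one_left Pm)
  rw [one_mul, one_mul] at hpow
  rw [htr, hpow, hflow, h, mul_add, partialTrace_add,
    partialTrace_kronecker_one_mul_mcomm ((Commute.refl Pm).pow_left m),
    partialTrace_kronecker_one_mul_mcomm_one_kronecker, zero_add, hM', mcomm,
    Matrix.smul_mul, Matrix.mul_smul, ← smul_sub, Matrix.smul_apply]
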